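/- Let V : ℝⁿ × [0,1] → ℝ be bounded, C², with ∇ₓV(·,t) L-Lipschitz in x uniformly in t, with L < 2/3. Let c_e(x,y) be the endpoint cost of the Lagrangian ½|γ'|² − V(γ,t). Then c_e satisfies the twist condition: for every y ∈ ℝⁿ and all x₁ ≠ x₂, ∇_y c_e(x₁,y) ≠ ∇_y c_e(x₂,y). In fact |∇_y c_e(x₁,y) − ∇_y c_e(x₂,y)| ≥ (1 − L/(2(1−L))) |x₁ − x₂| > 0. -/

import Mathlib

open MeasureTheory Set

/-- The endpoint cost `c_e(x,y)` of the Lagrangian `½|γ'|² − V(γ,t)`,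
obtained by minimizing over Lipschitz paths from `x` to `y`. -/
noncomputable def endCost (n : ℕ) (V : EuclideanSpace ℝ (Fin n) → ℝ → ℝ)
    (x y : EuclideanSpace ℝ (Fin n)) : ℝ :=
  sInf {r : ℝ | ∃ γ : ℝ → EuclideanSpace ℝ (Fin n),
    (∃ Lc : NNReal, LipschitzWith Lc γ) ∧ γ 0 = x ∧ γ 1 = y ∧
    r = ∫ t in (0:ℝ)..1, ((1/2) * ‖deriv γ t‖^2 - V (γ t) t)}


section helpers
set_option linter.unusedSectionVars false
variable {E : Type*} [NormedAddCommGroup E] [InnerProductSpace ℝ E] [FiniteDimensional ℝ E]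

noncomputable def twW (F : ℝ → E) (s : ℝ) : E := -∫ r in (0:ℝ)..s, F r

noncomputable def twU (x y : E) (F : ℝ → E) (s : ℝ) : E :=
  (y - x - ∫ r in (0:ℝ)..1, twW F r) + twW F s

noncomputable def twC (t : ℝ) : ℝ := max 0 (min 1 t)

noncomputable def twP (x y : E) (F : ℝ → E) (t : ℝ) : E :=
  x + ∫ s in (0:ℝ)..t, twU x y F (twC s)

lemma twC_cont : Continuous twC := by unfold twC; fun_prop

lemma twC_mem (t : ℝ) : twC t ∈ Icc (0:ℝ) 1 := by
  unfold twC; constructor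
  · exact le_max_left _ _
  · exact max_le zero_le_one (min_le_left _ _)

lemma twC_of_mem {t : ℝ} (h : t ∈ Icc (0:ℝ) 1) : twC t = t := by
  unfold twC; rw [min_eq_right h.2, max_eq_right h.1]

lemma twW_hasDeriv {F : ℝ → E} (hF : Continuous F) (s : ℝ) : HasDerivAt (twW F) (-F s) s := 
  (intervalIntegral.integral_hasDerivAt_right (hF.intervalIntegrable _ _)
    (hF.stronglyMeasurableAtFilter _ _) hF.continuousAt).neg

lemma twW_cont {F : ℝ → E} (hF : Continuous F) : Continuous (twW F) :=
  continuous_iff_continuousAt.2 fun s => (twW_hasDeriv hF s).continuousAt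

lemma twU_hasDeriv (x y : E) {F : ℝ → E} (hF : Continuous F) (s : ℝ) :
    HasDerivAt (twU x y F) (-F s) s := (twW_hasDeriv hF s).const_add _

lemma twU_cont (x y : E) {F : ℝ → E} (hF : Continuous F) : Continuous (twU x y F) :=
  continuous_const.add (twW_cont hF)

lemma twP_hasDeriv (x y : E) {F : ℝ → E} (hF : Continuous F) (t : ℝ) :
    HasDerivAt (twP x y F) (twU x y F (twC t)) t := by
  have hc : Continuous fun s => twU x y F (twC s) := (twU_cont x y hF).comp twC_cont
  exact (intervalIntegral.integral_hasDerivAt_right (hc.intervalIntegrable _ _)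
    (hc.stronglyMeasurableAtFilter _ _) hc.continuousAt).const_add x

lemma twP_cont (x y : E) {F : ℝ → E} (hF : Continuous F) : Continuous (twP x y F) :=
  continuous_iff_continuousAt.2 fun s => (twP_hasDeriv x y hF s).continuousAt

lemma twP_lip (x y : E) {F : ℝ → E} (hF : Continuous F) :
    ∃ C : NNReal, LipschitzWith C (twP x y F) := by
  obtain ⟨C, hC⟩ := isCompact_Icc.exists_bound_of_continuousOn
    (s := Icc (0:ℝ) 1) (twU_cont x y hF).continuousOn
  refine ⟨C.toNNReal, lipschitzWith_of_nnnorm_deriv_le 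
    (fun t => (twP_hasDeriv x y hF t).differentiableAt) fun t => ?_⟩
  rw [(twP_hasDeriv x y hF t).deriv, ← NNReal.coe_le_coe, coe_nnnorm]
  exact (hC _ (twC_mem t)).trans (Real.le_coe_toNNReal C)

lemma twP_eq (x y : E) {F : ℝ → E} (hF : Continuous F) {t : ℝ} (ht : t ∈ Icc (0:ℝ) 1) :
    twP x y F t = x + t • (y - x - ∫ r in (0:ℝ)..1, twW F r) + ∫ r in (0:ℝ)..t, twW F r := by
  have : ∫ s in (0:ℝ)..t, twU x y F (twC s) = ∫ s in (0:ℝ)..t, twU x y F s := by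
    apply intervalIntegral.integral_congr
    intro s hs
    rw [uIcc_of_le ht.1] at hs
    simp only
    rw [twC_of_mem ⟨hs.1, hs.2.trans ht.2⟩]
  unfold twP
  rw [this]
  unfold twU
  rw [intervalIntegral.integral_add (by simp) ((twW_cont hF).intervalIntegrable _ _)]
  rw [intervalIntegral.integral_const, sub_zero, add_assoc]

lemma twP_zero (x y : E) (F : ℝ → E) : twP x y F 0 = x := by simp [twP]

lemma twP_one (x y : E) {F : ℝ → E} (hF : Continuous F) : twP x y F 1 = y := by
  rw [twP_eq x y hF (by simp), one_smul]; abel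

lemma twW_sub {F₁ F₂ : ℝ → E} (h₁ : Continuous F₁) (h₂ : Continuous F₂) (s : ℝ) :
    twW F₁ s - twW F₂ s = twW (fun r => F₁ r - F₂ r) s := by
  unfold twW
  rw [intervalIntegral.integral_sub (h₁.intervalIntegrable _ _) (h₂.intervalIntegrable _ _)]
  abel

lemma twW_bound {F : ℝ → E} {M : ℝ} (hb : ∀ t ∈ Icc (0:ℝ) 1, ‖F t‖ ≤ M) {s : ℝ}
    (hs : s ∈ Icc (0:ℝ) 1) : ‖twW F s‖ ≤ M * s := by
  unfold twW
  rw [norm_neg]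
  refine (intervalIntegral.norm_integral_le_of_norm_le_const (C := M) fun r hr => ?_).trans ?_
  · rw [uIoc_of_le hs.1] at hr
    exact hb r ⟨hr.1.le, hr.2.trans hs.2⟩
  · rw [sub_zero, abs_of_nonneg hs.1]

lemma twWint_bound {F : ℝ → E} {M : ℝ} (hb : ∀ t ∈ Icc (0:ℝ) 1, ‖F t‖ ≤ M)
    {t : ℝ} (ht : t ∈ Icc (0:ℝ) 1) : ‖∫ r in (0:ℝ)..t, twW F r‖ ≤ M * (t ^ 2 / 2) := by
  have : ∫ r in (0:ℝ)..t, M * r = M * (t ^ 2 / 2) := by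
    rw [intervalIntegral.integral_const_mul, integral_id]; simp
  rw [← this]
  apply intervalIntegral.norm_integral_le_of_norm_le ht.1
  · refine Filter.Eventually.of_forall fun r hr => twW_bound hb ⟨hr.1.le, hr.2.trans ht.2⟩
  · exact (continuous_const.mul continuous_id).intervalIntegrable _ _

lemma twWint_sub {F₁ F₂ : ℝ → E} (h₁ : Continuous F₁) (h₂ : Continuous F₂) (s : ℝ) :
    (∫ r in (0:ℝ)..s, twW F₁ r) - (∫ r in (0:ℝ)..s, twW F₂ r)
      = ∫ r in (0:ℝ)..s, twW (fun r => F₁ r - F₂ r) r := by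
  rw [← intervalIntegral.integral_sub ((twW_cont h₁).intervalIntegrable _ _)
    ((twW_cont h₂).intervalIntegrable _ _)]
  simp_rw [twW_sub h₁ h₂]

lemma twP_diff (x₁ x₂ y : E) {F₁ F₂ : ℝ → E} (h₁ : Continuous F₁) (h₂ : Continuous F₂) {M : ℝ}
    (hM : 0 ≤ M)
    (hb : ∀ t ∈ Icc (0:ℝ) 1, ‖F₁ t - F₂ t‖ ≤ M) {t : ℝ} (ht : t ∈ Icc (0:ℝ) 1) :
    ‖twP x₁ y F₁ t - twP x₂ y F₂ t‖ ≤ ‖x₁ - x₂‖ + M := by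
  have e : twP x₁ y F₁ t - twP x₂ y F₂ t = (1 - t) • (x₁ - x₂)
      - t • (∫ r in (0:ℝ)..1, twW (fun r => F₁ r - F₂ r) r)
      + ∫ r in (0:ℝ)..t, twW (fun r => F₁ r - F₂ r) r := by
    rw [twP_eq _ _ h₁ ht, twP_eq _ _ h₂ ht, ← twWint_sub h₁ h₂, ← twWint_sub h₁ h₂]
    module
  rw [e]
  have b1 := twWint_bound hb (t := 1) (by simp)
  have b2 := twWint_bound hb ht
  have n1 : ‖(1 - t) • (x₁ - x₂)‖ ≤ ‖x₁ - x₂‖ := by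
    rw [norm_smul, Real.norm_of_nonneg (by linarith [ht.2])]
    exact mul_le_of_le_one_left (norm_nonneg _) (by linarith [ht.1])
  have n2 : ‖t • (∫ r in (0:ℝ)..1, twW (fun r => F₁ r - F₂ r) r)‖ ≤ M / 2 := by
    rw [norm_smul, Real.norm_of_nonneg ht.1]
    refine (mul_le_of_le_one_left (norm_nonneg _) ht.2).trans (b1.trans (le_of_eq (by ring)))
  have n3 : M * (t ^ 2 / 2) ≤ M / 2 := by
    have : t ^ 2 ≤ 1 := pow_le_one₀ ht.1 ht.2
    nlinarith
  refine (norm_add_le _ _).trans ?_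
  have := norm_sub_le ((1 - t) • (x₁ - x₂)) (t • (∫ r in (0:ℝ)..1, twW (fun r => F₁ r - F₂ r) r))
  linarith

lemma twU_diff (x₁ x₂ y : E) {F₁ F₂ : ℝ → E} (h₁ : Continuous F₁) (h₂ : Continuous F₂) {M : ℝ}
    (hb : ∀ t ∈ Icc (0:ℝ) 1, ‖F₁ t - F₂ t‖ ≤ M) :
    ‖x₁ - x₂‖ - M / 2 ≤ ‖twU x₁ y F₁ 1 - twU x₂ y F₂ 1‖ := by
  set D : ℝ → E := fun r => F₁ r - F₂ r with hD
  have hDc : Continuous D := h₁.sub h₂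
  have e : twU x₁ y F₁ 1 - twU x₂ y F₂ 1 = -(x₁ - x₂) + ∫ r in (0:ℝ)..1, (twW D 1 - twW D r) := by
    rw [intervalIntegral.integral_sub (by simp) ((twW_cont hDc).intervalIntegrable _ _),
      ← twWint_sub h₁ h₂, ← twW_sub h₁ h₂]
    unfold twU
    simp
    abel
  have b : ‖∫ r in (0:ℝ)..1, (twW D 1 - twW D r)‖ ≤ M / 2 := by
    have : ∫ r in (0:ℝ)..1, M * (1 - r) = M / 2 := by
      rw [intervalIntegral.integral_const_mul, intervalIntegral.integral_sub (by simp) (by simp), integral_id]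
      norm_num; ring
    rw [← this]
    apply intervalIntegral.norm_integral_le_of_norm_le zero_le_one
    · refine Filter.Eventually.of_forall fun r hr => ?_
      have : twW D 1 - twW D r = - ∫ s in r..1, D s := by
        unfold twW
        rw [← intervalIntegral.integral_add_adjacent_intervals (hDc.intervalIntegrable 0 r)
          (hDc.intervalIntegrable r 1)]
        abel
      rw [this, norm_neg]
      refine (intervalIntegral.norm_integral_le_of_norm_le_const (C := M) fun s hs => ?_).trans ?_
      · rw [uIoc_of_le hr.2] at hs
        exact hb s ⟨(hr.1.trans hs.1).le, hs.2⟩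
      · rw [abs_of_nonneg (by linarith [hr.2])]
    · exact (by fun_prop : Continuous fun r : ℝ => M * (1 - r)).intervalIntegrable _ _
  rw [e]
  have := norm_sub_norm_le (-(x₁ - x₂)) (-∫ r in (0:ℝ)..1, (twW D 1 - twW D r))
  rw [norm_neg, norm_neg, sub_neg_eq_add] at this
  linarith

lemma tw_bvp (G : E → ℝ → E) (hG : Continuous fun p : E × ℝ => G p.1 p.2) (L : ℝ) (hL0 : 0 ≤ L)
    (hL : L < 1) (hLip : ∀ t ∈ Icc (0:ℝ) 1, ∀ a b, ‖G a t - G b t‖ ≤ L * ‖a - b‖) (x y : E) :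
    ∃ F : ℝ → E, Continuous F ∧ ∀ t ∈ Icc (0:ℝ) 1, F t = G (twP x y F t) t := by
  let FF : C(Icc (0:ℝ) 1, E) → ℝ → E := fun γ s => G (γ ⟨twC s, twC_mem s⟩) (twC s)
  have hFF : ∀ γ, Continuous (FF γ) := fun γ =>
    hG.comp ((γ.continuous.comp (twC_cont.subtype_mk _)).prodMk twC_cont)
  let T : C(Icc (0:ℝ) 1, E) → C(Icc (0:ℝ) 1, E) := fun γ =>
    ⟨fun t => twP x y (FF γ) t, (twP_cont x y (hFF γ)).comp continuous_subtype_val⟩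
  have hT : ContractingWith L.toNNReal T := by
    refine ⟨by simpa using hL, LipschitzWith.of_dist_le_mul fun γ₁ γ₂ => ?_⟩
    rw [Real.coe_toNNReal _ hL0, ContinuousMap.dist_le (by positivity)]
    intro t
    rw [dist_eq_norm]
    have := twP_diff x x y (hFF γ₁) (hFF γ₂) (M := L * dist γ₁ γ₂) (by positivity) ?_ t.2
    · rw [sub_self, norm_zero, zero_add] at this; exact this
    · intro s hs
      refine (hLip _ (twC_mem s) _ _).trans ?_
      rw [← dist_eq_norm]
      exact mul_le_mul_of_nonneg_left (ContinuousMap.dist_apply_le_dist _) hL0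
  have hfix := hT.fixedPoint_isFixedPt
  set γ := ContractingWith.fixedPoint T hT
  refine ⟨FF γ, hFF γ, fun t ht => ?_⟩
  have h2 : γ ⟨t, ht⟩ = twP x y (FF γ) t := by
    conv_lhs => rw [← hfix.eq]
    rfl
  rw [← h2]
  simp only [FF, twC_of_mem ht]

open scoped RealInnerProductSpace

lemma tw_grad_cont {V : E → ℝ → ℝ} (hV : ContDiff ℝ 2 (fun p : E × ℝ => V p.1 p.2)) :
    Continuous fun p : E × ℝ => gradient (fun x => V x p.2) p.1 := by
  have h : ∀ p : E × ℝ, fderiv ℝ (fun x => V x p.2) p.1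
      = (fderiv ℝ (fun p : E × ℝ => V p.1 p.2) p).comp (ContinuousLinearMap.inl ℝ E ℝ) := by
    intro p
    have h1 := (hV.differentiable (by norm_num) p).hasFDerivAt
    have h2 : HasFDerivAt (fun x : E => (x, p.2)) (ContinuousLinearMap.inl ℝ E ℝ) p.1 :=
      hasFDerivAt_prodMk_left p.1 p.2
    exact (HasFDerivAt.comp (f := fun x : E => (x, p.2)) p.1 h1 h2).fderiv
  unfold gradient
  simp_rw [h]
  apply (LinearIsometryEquiv.continuous _).comp
  exact (hV.continuous_fderiv (by norm_num)).clm_comp continuous_const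

lemma tw_diff {V : E → ℝ → ℝ} (hV : ContDiff ℝ 2 (fun p : E × ℝ => V p.1 p.2)) (t : ℝ) :
    Differentiable ℝ fun x => V x t := by
  have : ContDiff ℝ 2 fun x : E => V x t := hV.comp (contDiff_prodMk_left t)
  exact this.differentiable (by norm_num)

lemma tw_taylor {f : E → ℝ} (hf : Differentiable ℝ f) {L : ℝ} 
    (hLip : ∀ a b, ‖gradient f a - gradient f b‖ ≤ L * ‖a - b‖) (a e : E) :
    |f (a + e) - f a - ⟪gradient f a, e⟫| ≤ L / 2 * ‖e‖ ^ 2 := by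
  have hd : ∀ s : ℝ, HasDerivAt (fun s : ℝ => f (a + s • e) - f a - s * ⟪gradient f a, e⟫)
      (⟪gradient f (a + s • e), e⟫ - ⟪gradient f a, e⟫) s := by
    intro s
    have h1 : HasDerivAt (fun s : ℝ => a + s • e) e s := by
      simpa using ((hasDerivAt_id s).smul_const e).const_add a
    have h2 := (hf (a + s • e)).hasFDerivAt.comp_hasDerivAt s h1
    rw [← inner_gradient_left] at h2
    have h3 := (hasDerivAt_id s).mul_const ⟪gradient f a, e⟫
    rw [one_mul] at h3
    exact (h2.sub_const _).sub h3
  have := image_norm_le_of_norm_deriv_right_le_deriv_boundary (a := 0) (b := 1)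
    (f := fun s : ℝ => f (a + s • e) - f a - s * ⟪gradient f a, e⟫)
    (B := fun s => L / 2 * ‖e‖ ^ 2 * s ^ 2) (B' := fun s => L / 2 * ‖e‖ ^ 2 * (2 * s))
    (fun s _ => (hd s).continuousAt.continuousWithinAt) (fun s _ => (hd s).hasDerivWithinAt)
    (by simp) (fun s => by simpa using (hasDerivAt_pow 2 s).const_mul (L / 2 * ‖e‖ ^ 2)) ?_
    (right_mem_Icc.2 zero_le_one)
  · simpa using this
  · intro s hs
    rw [← inner_sub_left]
    refine (norm_inner_le_norm _ _).trans ?_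
    have := hLip (a + s • e) a
    rw [add_sub_cancel_left, norm_smul, Real.norm_of_nonneg hs.1] at this
    calc _ ≤ (L * (s * ‖e‖)) * ‖e‖ := mul_le_mul_of_nonneg_right this (norm_nonneg _)
      _ = _ := by ring

noncomputable def twJ (V : E → ℝ → ℝ) (γ : ℝ → E) : ℝ :=
  ∫ t in (0:ℝ)..1, ((1/2) * ‖deriv γ t‖^2 - V (γ t) t)

lemma tw_integrable {V : E → ℝ → ℝ} (hV : Continuous (fun p : E × ℝ => V p.1 p.2)) 
    {γ : ℝ → E} {C : NNReal} (hγ : LipschitzWith C γ) :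
    IntervalIntegrable (fun t => (1/2) * ‖deriv γ t‖^2 - V (γ t) t) volume 0 1 := by
  borelize E
  apply IntervalIntegrable.sub
  · apply IntervalIntegrable.const_mul
    have : IntervalIntegrable (fun _ : ℝ => (C:ℝ) ^ 2) volume 0 1 := by simp
    refine this.mono_fun ?_ ?_
    · exact ((stronglyMeasurable_deriv γ).norm.pow 2).aestronglyMeasurable
    · refine Filter.Eventually.of_forall fun t => ?_
      have := norm_deriv_le_of_lipschitz (x₀ := t) hγ
      simp only [norm_pow, norm_norm, NNReal.norm_eq]
      gcongr
  · exact (hV.comp (hγ.continuous.prodMk continuous_id)).intervalIntegrable _ _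

lemma tw_ac_norm {X : Type*} [NormedAddCommGroup X] {f : ℝ → X} {a b : ℝ} 
    (hf : AbsolutelyContinuousOnInterval f a b) :
    AbsolutelyContinuousOnInterval (fun t => ‖f t‖ ^ 2) a b := by
  have h : AbsolutelyContinuousOnInterval (fun t => ‖f t‖) a b := by
    rw [absolutelyContinuousOnInterval_iff] at hf ⊢
    intro ε hε
    obtain ⟨δ, hδ, h⟩ := hf ε hε
    refine ⟨δ, hδ, fun I h1 h2 => lt_of_le_of_lt (Finset.sum_le_sum fun i _ => ?_) (h I h1 h2)⟩
    rw [dist_eq_norm (f _)]; exact dist_norm_norm_le (f (I.2 i).1) (f (I.2 i).2)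
  have := h.mul h
  convert this using 2 with t
  simp [sq]

lemma tw_ac_inner {f g : ℝ → E} {a b : ℝ} 
    (hf : AbsolutelyContinuousOnInterval f a b) (hg : AbsolutelyContinuousOnInterval g a b) :
    AbsolutelyContinuousOnInterval (fun t => ⟪f t, g t⟫) a b := by
  have := (((tw_ac_norm (hf.add hg)).sub (tw_ac_norm hf)).sub (tw_ac_norm hg)).const_mul (1/2)
  convert this using 2 with t
  simp only [Pi.sub_apply, Pi.add_apply]
  rw [norm_add_sq_real]; ring

lemma tw_lower {V : E → ℝ → ℝ} (hV : ContDiff ℝ 2 (fun p : E × ℝ => V p.1 p.2)) {L : ℝ} (hL : L ≤ 1)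
    (hLip : ∀ t ∈ Set.Icc (0:ℝ) 1, ∀ a b : E,
      ‖gradient (fun x => V x t) a - gradient (fun x => V x t) b‖ ≤ L * ‖a - b‖)
    (x y : E) {F : ℝ → E} (hF : Continuous F)
    (hFe : ∀ t ∈ Icc (0:ℝ) 1, F t = gradient (fun x => V x t) (twP x y F t))
    {σ : ℝ → E} {C : NNReal} (hσ : LipschitzWith C σ) (h0 : σ 0 = x) :
    twJ V (twP x y F) + ⟪twU x y F 1, σ 1 - y⟫ ≤ twJ V σ := by
  obtain ⟨C', hC'⟩ := twP_lip x y hF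
  have hη : LipschitzWith (C + C') (fun t => σ t - twP x y F t) := hσ.sub hC'
  set η : ℝ → E := fun t => σ t - twP x y F t with hηd
  set g : ℝ → ℝ := fun t => ⟪twU x y F t, η t⟫ + 1 / 2 * (Real.tan (1 - t) * ‖η t‖ ^ 2) with hg
  have hcos : ∀ t ∈ Icc (0:ℝ) 1, Real.cos (1 - t) ≠ 0 := by
    intro t ht
    apply ne_of_gt
    apply Real.cos_pos_of_mem_Ioo
    constructor <;> linarith [Real.pi_gt_three, ht.1, ht.2]
  have hηac : AbsolutelyContinuousOnInterval η 0 1 :=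
    (hη.lipschitzOnWith).absolutelyContinuousOnInterval
  have hUc : ContDiff ℝ 1 (twU x y F) := by
    rw [contDiff_one_iff_deriv]
    refine ⟨fun t => (twU_hasDeriv x y hF t).differentiableAt, ?_⟩
    have : deriv (twU x y F) = fun t => - F t := funext fun t => (twU_hasDeriv x y hF t).deriv
    rw [this]; exact hF.neg
  have htan : ContDiffOn ℝ 1 (fun t : ℝ => Real.tan (1 - t)) (uIcc 0 1) := by
    rw [uIcc_of_le zero_le_one]
    intro t ht
    apply ContDiffAt.contDiffWithinAt
    exact ContDiffAt.comp (f := fun t : ℝ => 1 - t) t (Real.contDiffAt_tan.2 (hcos t ht))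
      (by fun_prop)
  have hgac : AbsolutelyContinuousOnInterval g 0 1 :=
    (tw_ac_inner hUc.contDiffOn.absolutelyContinuousOnInterval hηac).add
      ((htan.absolutelyContinuousOnInterval.mul (tw_ac_norm hηac)).const_mul (1/2))
  have hint := hgac.integral_deriv_eq_sub
  have hg1 : g 1 = ⟪twU x y F 1, σ 1 - y⟫ := by simp [hg, hηd, twP_one x y hF]
  have hg0 : g 0 = 0 := by simp [hg, hηd, twP_zero, h0]
  rw [hg1, hg0, sub_zero] at hint
  have i1 := tw_integrable hV.continuous hσ
  have i2 := tw_integrable hV.continuous hC'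
  rw [← le_sub_iff_add_le', ← hint]
  unfold twJ
  rw [← intervalIntegral.integral_sub i1 i2]
  apply intervalIntegral.integral_mono_ae_restrict zero_le_one hgac.intervalIntegrable_deriv
    (i1.sub i2)
  have hae : ∀ᵐ t ∂(volume.restrict (Icc (0:ℝ) 1)), DifferentiableAt ℝ σ t :=
    ae_restrict_of_ae hσ.ae_differentiableAt_real
  filter_upwards [hae, ae_restrict_mem measurableSet_Icc] with t hσt ht
  have dP := twP_hasDeriv x y hF t
  rw [twC_of_mem ht] at dP
  have dη : HasDerivAt η (deriv σ t - twU x y F t) t := hσt.hasDerivAt.sub dP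
  set w := deriv σ t - twU x y F t with hw
  have hdσ : deriv σ t = twU x y F t + w := by simp [hw]
  have dT : HasDerivAt (fun t : ℝ => Real.tan (1 - t)) (-(1 + Real.tan (1 - t) ^ 2)) t := by
    have h1 := Real.hasDerivAt_tan (hcos t ht)
    have h2 : HasDerivAt (fun t : ℝ => 1 - t) (-1) t := by
      simpa using (hasDerivAt_id t).const_sub 1
    have h3 := HasDerivAt.comp (h := fun t : ℝ => 1 - t) t h1 h2
    have he : -(1 + Real.tan (1 - t) ^ 2) = 1 / Real.cos (1 - t) ^ 2 * -1 := by
      rw [Real.tan_eq_sin_div_cos]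
      have := hcos t ht
      field_simp
      linarith [Real.sin_sq_add_cos_sq (1 - t)]
    rw [he]
    exact h3
  have dg := ((twU_hasDeriv x y hF t).inner ℝ dη).add ((dT.mul dη.norm_sq).const_mul (1/2))
  have dg' := dg.deriv
  change deriv g t = _ at dg'
  have tay := tw_taylor (tw_diff hV t) (hLip t ht) (twP x y F t) (η t)
  rw [← hFe t ht] at tay
  have hse : twP x y F t + η t = σ t := by simp [hηd]
  rw [hse] at tay
  have tay' := (abs_le.1 tay).2
  rw [dg', dP.deriv, hdσ, norm_add_sq_real, inner_neg_left]
  set τ := Real.tan (1 - t)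
  have sq := norm_sub_sq_real w (τ • η t)
  rw [norm_smul, mul_pow, Real.norm_eq_abs, sq_abs, inner_smul_right, real_inner_comm] at sq
  have p1 := sq_nonneg ‖w - τ • η t‖
  have p2 : L * ‖η t‖ ^ 2 ≤ ‖η t‖ ^ 2 := mul_le_of_le_one_left (sq_nonneg _) hL
  nlinarith

lemma tw_upper {V : E → ℝ → ℝ} (hV : ContDiff ℝ 2 (fun p : E × ℝ => V p.1 p.2)) {L : ℝ} (hL : L ≤ 1)
    (hLip : ∀ t ∈ Set.Icc (0:ℝ) 1, ∀ a b : E,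
      ‖gradient (fun x => V x t) a - gradient (fun x => V x t) b‖ ≤ L * ‖a - b‖)
    (x y : E) {F : ℝ → E} (hF : Continuous F)
    (hFe : ∀ t ∈ Icc (0:ℝ) 1, F t = gradient (fun x => V x t) (twP x y F t)) (h : E) :
    ∃ σ : ℝ → E, (∃ C : NNReal, LipschitzWith C σ) ∧ σ 0 = x ∧ σ 1 = y + h ∧
    twJ V σ ≤ twJ V (twP x y F) + ⟪twU x y F 1, h⟫ + ‖h‖ ^ 2 := by
  obtain ⟨C', hC'⟩ := twP_lip x y hF
  have hh : LipschitzWith ‖h‖₊ (fun t : ℝ => t • h) := by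
    refine LipschitzWith.of_dist_le_mul fun s t => ?_
    rw [dist_eq_norm, ← sub_smul, norm_smul, dist_eq_norm, mul_comm]; rfl
  have hσ := hC'.add hh
  refine ⟨fun t => twP x y F t + t • h, ⟨_, hσ⟩, by simp [twP_zero], by simp [twP_one x y hF], ?_⟩
  have i1 := tw_integrable hV.continuous hσ
  have i2 := tw_integrable hV.continuous hC'
  have hd : ∀ t : ℝ, HasDerivAt (fun t : ℝ => ⟪twU x y F t, t • h⟫ + t * ‖h‖ ^ 2)
      (⟪twU x y F t, h⟫ - ⟪F t, t • h⟫ + ‖h‖ ^ 2) t := by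
    intro t
    have h1 : HasDerivAt (fun t : ℝ => t • h) h t := by
      simpa using (hasDerivAt_id t).smul_const h
    have h2 := ((twU_hasDeriv x y hF t).inner ℝ h1).add ((hasDerivAt_id t).mul_const (‖h‖ ^ 2))
    have he : ⟪twU x y F t, h⟫ - ⟪F t, t • h⟫ + ‖h‖ ^ 2
        = ⟪twU x y F t, h⟫ + ⟪-F t, t • h⟫ + 1 * ‖h‖ ^ 2 := by
      rw [inner_neg_left]; ring
    rw [he]
    exact h2
  have hc : Continuous fun t : ℝ => ⟪twU x y F t, h⟫ - ⟪F t, t • h⟫ + ‖h‖ ^ 2 := by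
    have := twU_cont x y hF
    fun_prop
  have hint := intervalIntegral.integral_eq_sub_of_hasDerivAt (a := 0) (b := 1)
    (fun t _ => hd t) (hc.intervalIntegrable _ _)
  simp only [one_smul, zero_smul, inner_zero_right, one_mul, zero_mul, add_zero, sub_zero] at hint
  rw [add_assoc, ← hint, ← sub_le_iff_le_add']
  unfold twJ
  rw [← intervalIntegral.integral_sub i1 i2]
  apply intervalIntegral.integral_mono_on zero_le_one (i1.sub i2) (hc.intervalIntegrable _ _)
  intro t ht
  have dP := twP_hasDeriv x y hF t
  rw [twC_of_mem ht] at dP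
  have h1 : HasDerivAt (fun t : ℝ => t • h) h t := by
    simpa using (hasDerivAt_id t).smul_const h
  have dS : deriv (fun t => twP x y F t + t • h) t = twU x y F t + h := (dP.add h1).deriv
  have tay := tw_taylor (tw_diff hV t) (hLip t ht) (twP x y F t) (t • h)
  rw [← hFe t ht] at tay
  have tay' := (abs_le.1 tay).1
  rw [dS, dP.deriv, norm_add_sq_real]
  have : L / 2 * ‖t • h‖ ^ 2 ≤ 1 / 2 * ‖h‖ ^ 2 := by
    rw [norm_smul, Real.norm_of_nonneg ht.1]
    have a1 : (t * ‖h‖) ^ 2 ≤ ‖h‖ ^ 2 := by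
      have := mul_le_of_le_one_left (norm_nonneg h) ht.2
      have := mul_nonneg ht.1 (norm_nonneg h)
      gcongr
    have a2 := sq_nonneg (t * ‖h‖)
    nlinarith
  linarith

end helpers

lemma tw_main (n : ℕ) (V : EuclideanSpace ℝ (Fin n) → ℝ → ℝ) (L : ℝ)
    (hV : ContDiff ℝ 2 (fun p : EuclideanSpace ℝ (Fin n) × ℝ => V p.1 p.2)) (hL : L ≤ 1)
    (hLip : ∀ t ∈ Set.Icc (0:ℝ) 1, ∀ a b : EuclideanSpace ℝ (Fin n),
      ‖gradient (fun x => V x t) a - gradient (fun x => V x t) b‖ ≤ L * ‖a - b‖)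
    (x y : EuclideanSpace ℝ (Fin n)) {F : ℝ → EuclideanSpace ℝ (Fin n)} (hF : Continuous F)
    (hFe : ∀ t ∈ Icc (0:ℝ) 1, F t = gradient (fun x => V x t) (twP x y F t)) :
    gradient (endCost n V x) y = twU x y F 1 := by
  have hlow : ∀ h, ∀ r ∈ {r : ℝ | ∃ γ : ℝ → EuclideanSpace ℝ (Fin n),
      (∃ Lc : NNReal, LipschitzWith Lc γ) ∧ γ 0 = x ∧ γ 1 = y + h ∧
      r = ∫ t in (0:ℝ)..1, ((1/2) * ‖deriv γ t‖^2 - V (γ t) t)},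
      twJ V (twP x y F) + inner ℝ (twU x y F 1) h ≤ r := by
    rintro h r ⟨γ, ⟨C, hC⟩, h0, h1, rfl⟩
    have := tw_lower hV hL hLip x y hF hFe hC h0
    rw [h1, add_sub_cancel_left] at this
    exact this
  have hb : ∀ h, twJ V (twP x y F) + inner ℝ (twU x y F 1) h ≤ endCost n V x (y + h) ∧
      endCost n V x (y + h) ≤ twJ V (twP x y F) + inner ℝ (twU x y F 1) h + ‖h‖ ^ 2 := by
    intro h
    obtain ⟨σ, hσ, h0, h1, hJ⟩ := tw_upper hV hL hLip x y hF hFe h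
    exact ⟨le_csInf ⟨_, σ, hσ, h0, h1, rfl⟩ (hlow h),
      (csInf_le ⟨_, hlow h⟩ ⟨σ, hσ, h0, h1, rfl⟩).trans hJ⟩
  have h0 : endCost n V x y = twJ V (twP x y F) := by
    have := hb 0
    simp only [add_zero, inner_zero_right, norm_zero] at this
    apply le_antisymm <;> linarith [this.1, this.2]
  apply HasGradientAt.gradient
  rw [hasGradientAt_iff_isLittleO_nhds_zero]
  have : (fun h => endCost n V x (y + h) - endCost n V x y - inner ℝ (twU x y F 1) h)
      =O[nhds 0] fun h => ‖h‖ ^ 2 := by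
    apply Asymptotics.IsBigO.of_bound 1
    refine Filter.Eventually.of_forall fun h => ?_
    rw [Real.norm_eq_abs, abs_of_nonneg (by linarith [(hb h).1]), norm_pow, norm_norm]
    linarith [(hb h).2]
  refine this.trans_isLittleO ?_
  exact Asymptotics.isLittleO_norm_pow_id one_lt_two

theorem endpoint_cost_twist (n : ℕ)
    (V : EuclideanSpace ℝ (Fin n) → ℝ → ℝ) (L K : ℝ)
    (hVbdd : ∀ x t, |V x t| ≤ K)
    (hV : ContDiff ℝ 2 (fun p : EuclideanSpace ℝ (Fin n) × ℝ => V p.1 p.2))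
    (hL0 : 0 ≤ L) (hL : L < 2/3)
    (hLip : ∀ t ∈ Set.Icc (0:ℝ) 1, ∀ a b : EuclideanSpace ℝ (Fin n),
      ‖gradient (fun x => V x t) a - gradient (fun x => V x t) b‖ ≤ L * ‖a - b‖)
    (y x₁ x₂ : EuclideanSpace ℝ (Fin n)) (hx : x₁ ≠ x₂) :
    (1 - L / (2 * (1 - L))) * ‖x₁ - x₂‖ ≤
      ‖gradient (endCost n V x₁) y - gradient (endCost n V x₂) y‖ ∧
    0 < ‖gradient (endCost n V x₁) y - gradient (endCost n V x₂) y‖ ∧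
    gradient (endCost n V x₁) y ≠ gradient (endCost n V x₂) y := by
  have hL1 : L ≤ 1 := by linarith
  have hGc := tw_grad_cont hV
  obtain ⟨F₁, c₁, e₁⟩ := tw_bvp (fun a t => gradient (fun x => V x t) a) hGc L hL0 (by linarith) hLip x₁ y
  obtain ⟨F₂, c₂, e₂⟩ := tw_bvp (fun a t => gradient (fun x => V x t) a) hGc L hL0 (by linarith) hLip x₂ y
  have hpos : 0 < ‖x₁ - x₂‖ := norm_pos_iff.2 (sub_ne_zero.2 hx)
  have key : (1 - L / (2 * (1 - L))) * ‖x₁ - x₂‖ ≤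
      ‖gradient (endCost n V x₁) y - gradient (endCost n V x₂) y‖ := by
    rw [tw_main n V L hV hL1 hLip x₁ y c₁ e₁, tw_main n V L hV hL1 hLip x₂ y c₂ e₂]
    obtain ⟨s, hs, hmax⟩ := isCompact_Icc.exists_isMaxOn (s := Icc (0:ℝ) 1) ⟨0, by simp⟩
      (f := fun t => ‖twP x₁ y F₁ t - twP x₂ y F₂ t‖)
      ((twP_cont x₁ y c₁).sub (twP_cont x₂ y c₂)).norm.continuousOn
    set D := ‖twP x₁ y F₁ s - twP x₂ y F₂ s‖ with hD
    have hD0 : 0 ≤ D := norm_nonneg _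
    have hFb : ∀ t ∈ Icc (0:ℝ) 1, ‖F₁ t - F₂ t‖ ≤ L * D := by
      intro t ht
      rw [e₁ t ht, e₂ t ht]
      exact (hLip t ht _ _).trans (mul_le_mul_of_nonneg_left (hmax ht) hL0)
    have hDb : D ≤ ‖x₁ - x₂‖ + L * D := twP_diff x₁ x₂ y c₁ c₂ (by positivity) hFb hs
    have hU := twU_diff x₁ x₂ y c₁ c₂ hFb
    refine le_trans ?_ hU
    have hD' : D ≤ ‖x₁ - x₂‖ / (1 - L) := by
      rw [le_div_iff₀ (by linarith)]; linarith
    have : L / (2 * (1 - L)) * ‖x₁ - x₂‖ = L / 2 * (‖x₁ - x₂‖ / (1 - L)) := by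
      rw [div_mul_div_comm, div_mul_eq_mul_div]
    rw [sub_mul, this]
    nlinarith [mul_le_mul_of_nonneg_left hD' (by linarith : 0 ≤ L / 2)]
  have hfac : 0 < 1 - L / (2 * (1 - L)) := by
    rw [sub_pos, div_lt_one (by linarith)]; linarith
  have h2 := lt_of_lt_of_le (mul_pos hfac hpos) key
  exact ⟨key, h2, sub_ne_zero.1 (norm_pos_iff.1 h2)⟩
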